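/- arXiv:0708.0854 — 2 statements merged into one kernel-verified Lean document; each statement's English description precedes it below -/
import Mathlib

section
/- Let δ > 0, r ∈ ℕ, b ∈ L_∞(ℝ), 1 ≤ p < ∞, and let μ ∈ ℂ with Re μ < δ. Then the formula (Kφ)(t) = e^{−δ|t|} ∫_{−∞}^{t} e^{μ(t−s)} (t−s)^r e^{−δ|s|} b(s) φ(s) ds defines a bounded linear operator on L_p(ℝ) which is compact. -/
open MeasureTheory
open Filter Topology Set
open scoped ENNReal NNReal

/-- The integral of an `S`-valued function against a density of total mass at most one lies in `S`,
for a closed convex set `S` containing `0`. -/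
theorem Convex.integral_smul_mem {α E : Type*} [MeasurableSpace α] {ν : Measure α}
    [NormedAddCommGroup E] [NormedSpace ℝ E] [CompleteSpace E] {S : Set E}
    (hS : Convex ℝ S) (hSc : IsClosed S) (h0 : (0 : E) ∈ S) {ρ : α → ℝ≥0}
    (hρ : AEMeasurable ρ ν) (hρ1 : ∫⁻ x, ρ x ∂ν ≤ 1) {u : α → E} (hu : ∀ x, u x ∈ S)
    (hint : Integrable (fun x => ρ x • u x) ν) : ∫ x, ρ x • u x ∂ν ∈ S := by
  rw [← integral_withDensity_eq_integral_smul₀ hρ]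
  rw [← integrable_withDensity_iff_integrable_smul₀ hρ] at hint
  set κ := ν.withDensity fun x => (ρ x : ℝ≥0∞) with hκ
  have huniv : κ univ ≤ 1 := by simpa [hκ] using hρ1
  have : IsFiniteMeasure κ := ⟨huniv.trans_lt ENNReal.one_lt_top⟩
  rcases eq_or_ne κ 0 with hz | hz
  · simpa [hz] using h0
  have : NeZero κ := ⟨hz⟩
  rw [← measure_smul_average]
  refine hS.smul_mem_of_zero_mem h0 (hS.average_mem hSc (ae_of_all _ hu) hint) ⟨by positivity, ?_⟩
  exact ENNReal.toReal_mono ENNReal.one_ne_top huniv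

/-- For a continuous curve `v` vanishing at infinity, `f ↦ ∫ f(s) v(s) ds` is compact on `L¹`: it maps
the unit ball into a closed convex hull of a compact set. -/
theorem isCompactOperator_integral_smul {X : Type*} [NormedAddCommGroup X] [NormedSpace ℂ X]
    [CompleteSpace X] {v : ℝ → X} (hv : Continuous v) (hv0 : Tendsto v (cocompact ℝ) (𝓝 0)) :
    ∃ I : Lp ℂ 1 (volume : Measure ℝ) →L[ℂ] X,
      (∀ f, I f = ∫ s, (f : ℝ → ℂ) s • v s) ∧ IsCompactOperator I := by
  have hL : IsCompact (insert 0 (range v)) := hv0.isCompact_insert_range_of_cocompact hv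
  obtain ⟨M, hM⟩ := hL.isBounded.exists_norm_le
  have hvM : ∀ s, ‖v s‖ ≤ M := fun s => hM _ (mem_insert_of_mem _ (mem_range_self s))
  have hint : ∀ f : Lp ℂ 1 (volume : Measure ℝ),
      Integrable (fun s => (f : ℝ → ℂ) s • v s) := fun f =>
    (L1.integrable_coeFn f).smul_bdd M hv.aestronglyMeasurable (ae_of_all _ hvM)
  let I₀ : Lp ℂ 1 (volume : Measure ℝ) →ₗ[ℂ] X :=
    { toFun := fun f => ∫ s, (f : ℝ → ℂ) s • v s
      map_add' := fun f g => by
        rw [← integral_add (hint f) (hint g)]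
        refine integral_congr_ae ?_
        filter_upwards [Lp.coeFn_add f g] with s hs
        change ((f + g : Lp ℂ 1 (volume : Measure ℝ)) : ℝ → ℂ) s • v s = _
        rw [hs, Pi.add_apply, add_smul]
      map_smul' := fun a f => by
        rw [RingHom.id_apply, ← integral_smul]
        refine integral_congr_ae ?_
        filter_upwards [Lp.coeFn_smul a f] with s hs
        simp [hs, mul_smul] }
  let I : Lp ℂ 1 (volume : Measure ℝ) →L[ℂ] X := I₀.mkContinuous M fun f => by
    rw [L1.norm_eq_integral_norm, ← integral_const_mul]
    refine norm_integral_le_of_norm_le ((L1.integrable_coeFn f).norm.const_mul M)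
      (ae_of_all _ fun s => ?_)
    rw [norm_smul, mul_comm]
    gcongr
    exact hvM s
  refine ⟨I, fun f => rfl, ?_⟩
  set D : Set X := (fun q : ℂ × X => q.1 • q.2) '' (Metric.closedBall 0 1 ×ˢ insert 0 (range v))
  have hDc : IsCompact D := ((isCompact_closedBall 0 1).prod hL).image continuous_smul
  have hDmem : ∀ a : ℂ, ‖a‖ ≤ 1 → ∀ s, a • v s ∈ D := fun a ha s =>
    ⟨(a, v s), ⟨by simpa using ha, mem_insert_of_mem _ (mem_range_self s)⟩, rfl⟩
  have hSc : IsCompact (closure (convexHull ℝ D)) :=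
    hDc.totallyBounded.convexHull.closure.isCompact_of_isClosed isClosed_closure
  have hsub : D ⊆ closure (convexHull ℝ D) := (subset_convexHull ℝ D).trans subset_closure
  refine (isCompactOperator_iff_image_closedBall_subset_compact I.toLinearMap one_pos).2
    ⟨_, hSc, ?_⟩
  rintro _ ⟨f, hf, rfl⟩
  have hpolar : ∀ s, (f : ℝ → ℂ) s • v s =
      ‖(f : ℝ → ℂ) s‖₊ • (((f : ℝ → ℂ) s / ‖(f : ℝ → ℂ) s‖) • v s) := fun s => by
    rcases eq_or_ne ((f : ℝ → ℂ) s) 0 with h | h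
    · simp [h]
    · rw [NNReal.smul_def, ← Complex.coe_smul, smul_smul, coe_nnnorm, mul_div_cancel₀]
      simpa using h
  have hfi := hint f
  change ∫ s, (f : ℝ → ℂ) s • v s ∈ _
  simp only [hpolar] at hfi ⊢
  refine (convex_convexHull ℝ D).closure.integral_smul_mem isClosed_closure
    (hsub ⟨(0, 0), by simp, by simp⟩) (Lp.aestronglyMeasurable f).nnnorm.aemeasurable ?_
    (fun s => hsub (hDmem _ ?_ s)) hfi
  · rw [mem_closedBall_zero_iff, L1.norm_eq_integral_norm,
      integral_norm_eq_lintegral_enorm (Lp.aestronglyMeasurable f)] at hf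
    exact (ENNReal.toReal_le_toReal (L1.integrable_coeFn f).2.ne ENNReal.one_ne_top).1
      (by simpa using hf)
  · rw [norm_div, Complex.norm_real, norm_norm]
    exact div_self_le_one _

/-- Dominated convergence for a kernel regarded as an `Lᵖ`-valued curve. -/
theorem continuous_toLp_of_dominated {p : ℝ≥0∞} [hp : Fact (1 ≤ p)] (hp2 : p ≠ ∞)
    {h : ℝ → ℝ → ℂ} {G : ℝ → ℝ} (hmem : ∀ s, MemLp (h s) p volume) (hG : MemLp G p volume)
    (hb : ∀ s t, ‖h s t‖ ≤ G t) (hc : ∀ s₀, ∀ᵐ t, ContinuousAt (fun s => h s t) s₀) :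
    Continuous fun s => (hmem s).toLp (h s) := by
  have hp0 : p ≠ 0 := (zero_lt_one.trans_le hp.out).ne'
  have hp' : 0 < p.toReal := ENNReal.toReal_pos hp0 hp2
  refine continuous_iff_continuousAt.2 fun s₀ => ?_
  refine (Lp.tendsto_Lp_iff_tendsto_eLpNorm'' h hmem (h s₀) (hmem s₀)).2 ?_
  simp only [eLpNorm_eq_lintegral_rpow_enorm_toReal hp0 hp2]
  have hlim : Tendsto (fun s => ∫⁻ t, ‖(h s - h s₀) t‖ₑ ^ p.toReal) (𝓝 s₀)
      (𝓝 (∫⁻ _ : ℝ, 0)) := by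
    refine tendsto_lintegral_filter_of_dominated_convergence'
      (fun t => ‖(2 * G t : ℝ)‖ₑ ^ p.toReal) (Eventually.of_forall fun s => ?_)
      (Eventually.of_forall fun s => ae_of_all _ fun t => ?_) ?_ ?_
    · exact ((hmem s).1.sub (hmem s₀).1).enorm.pow_const _
    · refine ENNReal.rpow_le_rpow (enorm_le_iff_norm_le.2 ?_) hp'.le
      rw [Pi.sub_apply]
      refine (norm_sub_le _ _).trans ((add_le_add (hb s t) (hb s₀ t)).trans ?_)
      rw [← two_mul]
      exact le_abs_self _
    · exact (lintegral_rpow_enorm_lt_top_of_eLpNorm_lt_top hp0 hp2 (hG.const_mul 2).2).ne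
    · filter_upwards [hc s₀] with t ht
      have h1 : Tendsto (fun s => ‖(h s - h s₀) t‖ₑ) (𝓝 s₀) (𝓝 0) := by
        have := (ht.sub (continuousAt_const (y := h s₀ t))).enorm
        simpa [ContinuousAt] using this
      simpa [ENNReal.zero_rpow_of_pos hp'] using h1.ennrpow_const p.toReal
  have := hlim.ennrpow_const (1 / p.toReal)
  simpa [ENNReal.zero_rpow_of_pos (inv_pos.2 hp')] using this

/-- The `Lᵖ`-valued Bochner integral of a dominated kernel is given by the pointwise integral. -/
theorem coeFn_integral_smul_toLp {p : ℝ≥0∞} [hp : Fact (1 ≤ p)]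
    {h : ℝ → ℝ → ℂ} {G : ℝ → ℝ} (hmeas : Measurable (Function.uncurry h))
    (hmem : ∀ s, MemLp (h s) p volume) (hG : Integrable G)
    (hb : ∀ s t, ‖h s t‖ ≤ G t) {f : ℝ → ℂ} (hf : Integrable f)
    (hint : Integrable fun s => f s • (hmem s).toLp (h s)) :
    (∫ s, f s • (hmem s).toLp (h s) : Lp ℂ p (volume : Measure ℝ)) =ᵐ[volume]
      fun t => ∫ s, f s * h s t := by
  have := ENNReal.HolderConjugate.inv_one_sub_inv' hp.out
  have : Fact (1 ≤ (1 - p⁻¹)⁻¹) := by simp [fact_iff]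
  have hprod : Integrable (fun q : ℝ × ℝ => f q.1 * h q.1 q.2) (volume.prod volume) := by
    refine (hf.mul_prod hG.ofReal).mono
      (hf.1.comp_fst.mul hmeas.aestronglyMeasurable) (ae_of_all _ fun q => ?_)
    rw [norm_mul, norm_mul, RCLike.norm_ofReal]
    gcongr
    exact (hb _ _).trans (le_abs_self _)
  refine ae_eq_of_forall_setIntegral_eq_of_sigmaFinite (fun A hA hμA => ?_)
    (fun A _ _ => hprod.integral_prod_right.integrableOn) fun A hA hμA => ?_
  · have : IsFiniteMeasure (volume.restrict A) := ⟨by simpa using hμA⟩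
    exact ((Lp.memLp _).restrict A).integrable hp.out
  let Λ : Lp ℂ p (volume : Measure ℝ) →L[ℂ] ℂ :=
    (ContinuousLinearMap.mul ℂ ℂ).lpPairing volume (1 - p⁻¹)⁻¹ p
      (indicatorConstLp _ hA hμA.ne (1 : ℂ))
  have hΛ : ∀ u : Lp ℂ p (volume : Measure ℝ), Λ u = ∫ t in A, (u : ℝ → ℂ) t := fun u => by
    rw [← integral_indicator hA]
    refine (ContinuousLinearMap.lpPairing_eq_integral _ _ _).trans (integral_congr_ae ?_)
    filter_upwards [indicatorConstLp_coeFn (p := (1 - p⁻¹)⁻¹) (hs := hA) (hμs := hμA.ne)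
      (c := (1 : ℂ))] with t ht
    rw [ht]
    by_cases htA : t ∈ A <;> simp [htA]
  rw [← hΛ, ← Λ.integral_comp_comm hint, ← integral_integral_swap]
  · refine integral_congr_ae (ae_of_all _ fun s => ?_)
    change Λ (f s • (hmem s).toLp (h s)) = ∫ t in A, f s * h s t
    rw [map_smul, hΛ, smul_eq_mul, integral_const_mul]
    congr 1
    exact integral_congr_ae (ae_restrict_of_ae (hmem s).coeFn_toLp)
  · refine hprod.mono_measure ?_
    exact Measure.prod_mono le_rfl Measure.restrict_le_self

theorem integrable_exp_neg_mul_abs {c : ℝ} (hc : 0 < c) :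
    Integrable fun t : ℝ => Real.exp (-c * |t|) := by
  rw [← integrableOn_univ, ← Iic_union_Ioi (a := (0 : ℝ)), integrableOn_union]
  constructor
  · refine (integrableOn_exp_mul_Iic hc 0).congr_fun (fun t ht => ?_) measurableSet_Iic
    simp [abs_of_nonpos (mem_Iic.1 ht)]
  · refine (integrableOn_exp_mul_Ioi (neg_lt_zero.2 hc) 0).congr_fun (fun t ht => ?_)
      measurableSet_Ioi
    simp [abs_of_pos (mem_Ioi.1 ht)]

theorem memLp_exp_neg_mul_abs {c : ℝ} (hc : 0 < c) (p : ℝ≥0∞) :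
    MemLp (fun t : ℝ => Real.exp (-c * |t|)) p volume := by
  have hmeas : AEStronglyMeasurable (fun t : ℝ => Real.exp (-c * |t|)) volume := by fun_prop
  rcases eq_or_ne p 0 with rfl | hp0
  · exact memLp_zero_iff_aestronglyMeasurable.2 hmeas
  rcases eq_or_ne p ∞ with rfl | hp
  · refine memLp_top_of_bound hmeas 1 (ae_of_all _ fun t => ?_)
    rw [Real.norm_eq_abs, Real.abs_exp, Real.exp_le_one_iff, neg_mul]
    exact neg_nonpos.2 (by positivity)
  · rw [← integrable_norm_rpow_iff hmeas hp0 hp]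
    refine (integrable_exp_neg_mul_abs
      (mul_pos hc (ENNReal.toReal_pos hp0 hp))).congr (ae_of_all _ fun t => ?_)
    simp only [Real.norm_eq_abs, Real.abs_exp, ← Real.exp_mul]
    ring_nf

/-- The weighted kernel decays exponentially in both variables, with room to spare in `s`. -/
theorem exists_norm_kernel_le {δ : ℝ} (r : ℕ) {μ : ℂ} (hδ : 0 < δ) (hμ : μ.re < δ) :
    ∃ c > 0, ∃ C ≥ 0, ∀ s t : ℝ, s ≤ t →
      ‖(Real.exp (-δ * |t|) : ℂ) * (Complex.exp (μ * ((t : ℂ) - (s : ℂ))) *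
        ((t : ℂ) - (s : ℂ)) ^ r * (Real.exp (-δ * |s|) : ℂ)) * (Real.exp (c * |s|) : ℂ)‖ ≤
      Real.exp (-c * |s|) * (C * Real.exp (-c * |t|)) := by
  set m := max μ.re 0
  have hm : 0 < δ - m := sub_pos.2 (max_lt hμ hδ)
  have hm0 : 0 ≤ m := le_max_right _ _
  obtain ⟨c, hc⟩ : ∃ c, c = (δ - m) / 4 := ⟨_, rfl⟩
  have hc0 : 0 < c := by linarith
  refine ⟨c, hc0, r.factorial / (2 * c) ^ r, by positivity, fun s t hst => ?_⟩
  have hx : 0 ≤ t - s := sub_nonneg.2 hst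
  have hxs : t - s ≤ |t| + |s| := by linarith [le_abs_self t, neg_abs_le s]
  have hpow : (t - s) ^ r ≤ r.factorial / (2 * c) ^ r * Real.exp (2 * c * (t - s)) := by
    have := Real.pow_div_factorial_le_exp (x := 2 * c * (t - s)) (by positivity) r
    rw [div_mul_eq_mul_div, le_div_iff₀ (by positivity)]
    rw [div_le_iff₀ (by positivity), mul_pow] at this
    linarith
  have hnorm : ‖(Real.exp (-δ * |t|) : ℂ) * (Complex.exp (μ * ((t : ℂ) - (s : ℂ))) *
        ((t : ℂ) - (s : ℂ)) ^ r * (Real.exp (-δ * |s|) : ℂ)) * (Real.exp (c * |s|) : ℂ)‖ =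
      Real.exp (-δ * |t|) * (Real.exp (μ.re * (t - s)) * (t - s) ^ r * Real.exp (-δ * |s|)) *
        Real.exp (c * |s|) := by
    rw [← Complex.ofReal_sub]
    simp only [norm_mul, norm_pow, Complex.norm_real, Complex.norm_exp, Complex.re_mul_ofReal,
      Real.norm_eq_abs, Real.abs_exp, abs_of_nonneg hx]
  rw [hnorm]
  calc _ ≤ Real.exp (-δ * |t|) * (Real.exp (m * (|t| + |s|)) *
        (r.factorial / (2 * c) ^ r * Real.exp (2 * c * (|t| + |s|))) * Real.exp (-δ * |s|)) *
        Real.exp (c * |s|) := by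
        have h1 : μ.re * (t - s) ≤ m * (|t| + |s|) :=
          (mul_le_mul_of_nonneg_right (le_max_left _ _) hx).trans
            (mul_le_mul_of_nonneg_left hxs hm0)
        have h2 : (t - s) ^ r ≤ r.factorial / (2 * c) ^ r * Real.exp (2 * c * (|t| + |s|)) :=
          hpow.trans (by gcongr)
        gcongr
    _ = r.factorial / (2 * c) ^ r * Real.exp (-δ * |t| + m * (|t| + |s|) + 2 * c * (|t| + |s|)
        + -δ * |s| + c * |s|) := by
        simp only [Real.exp_add]
        ring
    _ ≤ r.factorial / (2 * c) ^ r * Real.exp (-c * |s| + -c * |t|) := by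
        refine mul_le_mul_of_nonneg_left (Real.exp_le_exp.2 ?_) (by positivity)
        have : δ = m + 4 * c := by linarith
        rw [this]
        nlinarith [abs_nonneg t, abs_nonneg s, mul_nonneg hc0.le (abs_nonneg t)]
    _ = _ := by
        rw [Real.exp_add]
        ring

theorem tendsto_exp_neg_mul_abs_cocompact {c : ℝ} (hc : 0 < c) :
    Tendsto (fun s : ℝ => Real.exp (-c * |s|)) (cocompact ℝ) (𝓝 0) := by
  refine Real.tendsto_exp_atBot.comp ?_
  exact (tendsto_norm_cocompact_atTop (E := ℝ)).const_mul_atTop_of_neg (neg_lt_zero.2 hc)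

/-- For `δ > 0`, `r ∈ ℕ`, `b ∈ L_∞(ℝ)`, `1 ≤ p < ∞` and `Re μ < δ`,
the weighted causal formula
`(Kφ)(t) = e^{-δ|t|} ∫_{-∞}^t e^{μ(t-s)}(t-s)^r e^{-δ|s|} b(s) φ(s) ds`
defines a bounded linear operator on `L_p(ℝ)` which is compact. -/
theorem statement10 (δ : ℝ) (hδ : 0 < δ) (r : ℕ)
    (b : Lp ℂ ⊤ (volume : Measure ℝ))
    (p : ENNReal) [Fact (1 ≤ p)] (hp2 : p ≠ ⊤)
    (μ : ℂ) (hμ : μ.re < δ) :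
    ∃ K : Lp ℂ p (volume : Measure ℝ) →L[ℂ] Lp ℂ p (volume : Measure ℝ),
      (∀ φ : Lp ℂ p (volume : Measure ℝ), ∀ᵐ t : ℝ ∂volume,
        (K φ : ℝ → ℂ) t = (Real.exp (-δ * |t|) : ℂ) * ∫ s in Set.Iic t,
          Complex.exp (μ * ((t : ℂ) - (s : ℂ))) * ((t : ℂ) - (s : ℂ)) ^ r *
            (Real.exp (-δ * |s|) : ℂ) * (b : ℝ → ℂ) s * (φ : ℝ → ℂ) s) ∧
      IsCompactOperator K := by
  obtain ⟨c, hc, C, hC, hbound⟩ := exists_norm_kernel_le r hδ hμ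
  let a : ℝ → ℝ → ℂ := fun s t => (Real.exp (-δ * |t|) : ℂ) *
    (Complex.exp (μ * ((t : ℂ) - (s : ℂ))) * ((t : ℂ) - (s : ℂ)) ^ r *
      (Real.exp (-δ * |s|) : ℂ)) * (Real.exp (c * |s|) : ℂ)
  have ha : Continuous (Function.uncurry a) := by
    simp only [a, Function.uncurry_def]
    fun_prop
  let h : ℝ → ℝ → ℂ := fun s t => if s ≤ t then a s t else 0
  have hmeas : Measurable (Function.uncurry h) :=
    Measurable.ite (measurableSet_le measurable_fst measurable_snd) ha.measurable measurable_const
  have hb : ∀ s t, ‖h s t‖ ≤ Real.exp (-c * |s|) * (C * Real.exp (-c * |t|)) := fun s t => by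
    by_cases hst : s ≤ t
    · simpa only [h, if_pos hst] using hbound s t hst
    · simp only [h, if_neg hst, norm_zero]
      positivity
  have hb' : ∀ s t, ‖h s t‖ ≤ C * Real.exp (-c * |t|) := fun s t =>
    (hb s t).trans (mul_le_of_le_one_left (by positivity)
      (Real.exp_le_one_iff.2 (by rw [neg_mul]; exact neg_nonpos.2 (mul_nonneg hc.le (abs_nonneg _)))))
  have hG : MemLp (fun t : ℝ => C * Real.exp (-c * |t|)) p volume :=
    (memLp_exp_neg_mul_abs hc p).const_mul C
  have hmem : ∀ s, MemLp (h s) p volume := fun s =>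
    hG.mono' (hmeas.of_uncurry_left (x := s)).aestronglyMeasurable (ae_of_all _ (hb' s))
  have hcont : ∀ s₀, ∀ᵐ t, ContinuousAt (fun s => h s t) s₀ := fun s₀ => by
    filter_upwards [compl_mem_ae_iff.2 (measure_singleton (μ := volume) s₀)] with t ht
    rcases lt_or_gt_of_ne (show t ≠ s₀ from ht) with hlt | hlt
    · refine (continuousAt_const (y := (0 : ℂ))).congr ?_
      filter_upwards [lt_mem_nhds hlt] with s hs
      simp only [h, if_neg (not_le.2 hs)]
    · refine ContinuousAt.congr (f := fun s => a s t) ?_ ?_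
      · exact (ha.comp (by fun_prop : Continuous fun s : ℝ => (s, t))).continuousAt
      · filter_upwards [gt_mem_nhds hlt] with s hs
        simp only [h, if_pos hs.le]
  have hv := continuous_toLp_of_dominated hp2 hmem hG hb' hcont
  have hv0 : Tendsto (fun s => (hmem s).toLp (h s)) (cocompact ℝ) (𝓝 0) := by
    refine squeeze_zero_norm (a := fun s : ℝ => Real.exp (-c * |s|) * ‖hG.toLp _‖) (fun s => ?_)
      (by simpa using (tendsto_exp_neg_mul_abs_cocompact hc).mul_const ‖hG.toLp _‖)
    refine Lp.norm_le_mul_norm_of_ae_le_mul ?_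
    filter_upwards [(hmem s).coeFn_toLp, hG.coeFn_toLp] with t h1 h2
    rw [h1, h2]
    exact (hb s t).trans (mul_le_mul_of_nonneg_left (le_abs_self _) (Real.exp_pos _).le)
  obtain ⟨I, hI, hIc⟩ := isCompactOperator_integral_smul hv hv0
  have := ENNReal.HolderConjugate.inv_one_sub_inv' (Fact.out : 1 ≤ p)
  have : Fact (1 ≤ (1 - p⁻¹)⁻¹) := by simp [fact_iff]
  have hw : MemLp (fun s => (b : ℝ → ℂ) s * (Real.exp (-c * |s|) : ℂ)) (1 - p⁻¹)⁻¹ volume :=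
    (memLp_exp_neg_mul_abs hc (1 - p⁻¹)⁻¹).ofReal.mul (Lp.memLp b)
  let T : Lp ℂ p (volume : Measure ℝ) →L[ℂ] Lp ℂ 1 (volume : Measure ℝ) :=
    (ContinuousLinearMap.mul ℂ ℂ).holderL volume (1 - p⁻¹)⁻¹ p 1 (hw.toLp _)
  have hT : ∀ φ, (T φ : ℝ → ℂ) =ᵐ[volume]
      fun s => (b : ℝ → ℂ) s * (Real.exp (-c * |s|) : ℂ) * (φ : ℝ → ℂ) s := fun φ => by
    filter_upwards [(ContinuousLinearMap.mul ℂ ℂ).coeFn_holder (r := 1) (hw.toLp _) φ,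
      hw.coeFn_toLp] with s h1 h2
    refine h1.trans ?_
    rw [h2]
    rfl
  refine ⟨I.comp T, fun φ => ?_, hIc.comp_clm T⟩
  obtain ⟨M, hM⟩ := (hv0.isCompact_insert_range_of_cocompact hv).isBounded.exists_norm_le
  have hfi := L1.integrable_coeFn (T φ)
  have hint := hfi.smul_bdd M hv.aestronglyMeasurable
    (ae_of_all _ fun s => hM _ (mem_insert_of_mem _ (mem_range_self s)))
  have key := coeFn_integral_smul_toLp hmeas hmem ((integrable_exp_neg_mul_abs hc).const_mul C)
    hb' hfi hint
  rw [ContinuousLinearMap.comp_apply, hI]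
  filter_upwards [key] with t ht
  refine ht.trans ?_
  rw [← integral_const_mul, ← integral_indicator measurableSet_Iic]
  refine integral_congr_ae ?_
  filter_upwards [hT φ] with s hs
  rw [hs]
  by_cases hst : s ≤ t
  · have hexp : (Real.exp (-c * |s|) : ℂ) * (Real.exp (c * |s|) : ℂ) = 1 := by
      rw [← Complex.ofReal_mul, ← Real.exp_add]
      simp
    simp only [h, a, if_pos hst, indicator_of_mem (mem_Iic.2 hst)]
    linear_combination ((b : ℝ → ℂ) s * (φ : ℝ → ℂ) s * (Real.exp (-δ * |t|) : ℂ) *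
      (Complex.exp (μ * ((t : ℂ) - (s : ℂ))) * ((t : ℂ) - (s : ℂ)) ^ r *
      (Real.exp (-δ * |s|) : ℂ))) * hexp
  · simp only [h, if_neg hst, mul_zero]
    rw [indicator_of_notMem (by simpa using hst)]
end

section
/- Let δ > 0, r ∈ ℕ, b ∈ L_∞(ℝ), 1 ≤ p < ∞, and let μ ∈ ℂ with Re μ > −δ. Then the formula (Kφ)(t) = e^{−δ|t|} ∫_{t}^{+∞} e^{μ(t−s)} (s−t)^r e^{−δ|s|} b(s) φ(s) ds defines a bounded linear operator on L_p(ℝ) which is compact. -/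
open MeasureTheory
open Filter Set
open scoped Topology ENNReal

theorem exists_isCompactOperator_integral_smul {α 𝕜 E : Type*} [MeasurableSpace α]
    {ν : Measure α} [RCLike 𝕜] [NormedAddCommGroup E] [NormedSpace ℝ E] [NormedSpace 𝕜 E]
    [IsScalarTower ℝ 𝕜 E] [CompleteSpace E] {G : α → E} (hG : AEStronglyMeasurable G ν)
    {S : Set E} (hS : IsCompact S) (hGS : ∀ a, G a ∈ S) :
    ∃ T : Lp 𝕜 1 ν →L[𝕜] E, (∀ g, T g = ∫ a, g a • G a ∂ν) ∧ IsCompactOperator T := by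
  obtain ⟨C, hC⟩ := hS.isBounded.exists_norm_le
  have hGtop : MemLp G ⊤ ν := memLp_top_of_bound hG C (.of_forall fun a => hC _ (hGS a))
  have hinteg (g : Lp 𝕜 1 ν) : Integrable (fun a => g a • G a) ν :=
    (L1.integrable_coeFn g).smul_of_top_left hGtop
  let T : Lp 𝕜 1 ν →L[𝕜] E := LinearMap.mkContinuous
    { toFun := fun g => ∫ a, g a • G a ∂ν
      map_add' := fun g h => by
        rw [← integral_add (hinteg g) (hinteg h)]
        refine integral_congr_ae ?_
        filter_upwards [Lp.coeFn_add g h] with a ha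
        simp only [ha, Pi.add_apply, add_smul]
      map_smul' := fun c g => by
        rw [RingHom.id_apply, ← integral_smul]
        refine integral_congr_ae ?_
        filter_upwards [Lp.coeFn_smul c g] with a ha
        simp [ha, mul_smul] } C fun g => by
      rw [L1.norm_eq_integral_norm, ← integral_const_mul]
      refine norm_integral_le_of_norm_le ((L1.integrable_coeFn g).norm.const_mul C)
        (.of_forall fun a => ?_)
      rw [norm_smul, mul_comm]
      exact mul_le_mul_of_nonneg_right (hC _ (hGS a)) (norm_nonneg _)
  have hT (g : Lp 𝕜 1 ν) : T g = ∫ a, g a • G a ∂ν := rfl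
  refine ⟨T, hT, ?_⟩
  let P : Set E := (fun z : 𝕜 × E => z.1 • z.2) '' (Metric.closedBall 0 1 ×ˢ S)
  have hP : IsCompact P := ((isCompact_closedBall 0 1).prod hS).image (by fun_prop)
  have hQ : IsCompact (closure (convexHull ℝ P)) :=
    isCompact_iff_totallyBounded_isComplete.2
      ⟨hP.totallyBounded.convexHull.closure, isClosed_closure.isComplete⟩
  have hPQ : P ⊆ closure (convexHull ℝ P) := (subset_convexHull ℝ P).trans subset_closure
  refine (isCompactOperator_iff_image_closedBall_subset_compact (T : Lp 𝕜 1 ν →ₛₗ[RingHom.id 𝕜] E)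
    one_pos).2 ⟨insert 0 (closure (convexHull ℝ P)), hQ.insert 0, ?_⟩
  rintro _ ⟨g, hg, rfl⟩
  rcases isEmpty_or_nonempty α with hα | ⟨⟨a₀⟩⟩
  · left
    have : Subsingleton (Lp 𝕜 1 ν) := ⟨fun f g => Lp.ext (.of_forall fun a => (hα.false a).elim)⟩
    simp [Subsingleton.elim g 0]
  right
  by_contra hmem
  obtain ⟨f, u, hfu, hu⟩ := RCLike.geometric_hahn_banach_closed_point (𝕜 := 𝕜)
    (convex_convexHull ℝ P).closure isClosed_closure hmem
  have hu0 : 0 < u := by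
    simpa using hfu 0 (hPQ ⟨(0, G a₀), ⟨by simp, hGS a₀⟩, by simp⟩)
  have hbound (a : α) : RCLike.re (f (g a • G a)) ≤ ‖g a‖ * u := by
    rcases eq_or_ne (g a) 0 with h0 | h0
    · simp [h0]
    have hn : (‖g a‖ : 𝕜) ≠ 0 := by simpa using h0
    have h1 := hfu ((((‖g a‖ : ℝ) : 𝕜)⁻¹ * g a) • G a)
      (hPQ ⟨(_, G a), ⟨by simp [h0], hGS a⟩, rfl⟩)
    have h2 : f (g a • G a) = (‖g a‖ : 𝕜) * f ((((‖g a‖ : ℝ) : 𝕜)⁻¹ * g a) • G a) := by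
      simp only [map_smul, smul_eq_mul]
      field_simp
    rw [h2, RCLike.re_ofReal_mul]
    gcongr
  have hnorm : ∫ a, ‖g a‖ ∂ν ≤ 1 := by
    rw [← L1.norm_eq_integral_norm]; simpa using hg
  have : RCLike.re (f (T g)) ≤ u := calc
    RCLike.re (f (T g)) = ∫ a, RCLike.re (f (g a • G a)) ∂ν := by
      rw [hT, ← ContinuousLinearMap.integral_comp_comm f (hinteg g)]
      exact (integral_re (f.integrable_comp (hinteg g))).symm
    _ ≤ ∫ a, ‖g a‖ * u ∂ν := integral_mono (f.integrable_comp (hinteg g)).re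
        ((L1.integrable_coeFn g).norm.mul_const u) hbound
    _ ≤ u := by
      rw [integral_mul_const]
      exact mul_le_of_le_one_left hu0.le hnorm
  exact absurd hu (not_lt.2 this)

theorem coeFn_integral_smul_Lp {α β : Type*} [MeasurableSpace α] [MeasurableSpace β]
    {κ : Measure α} {ν : Measure β} [SFinite κ] [SigmaFinite ν] {p : ℝ≥0∞} [Fact (1 ≤ p)]
    {k : α → β → ℂ} (hk : StronglyMeasurable (Function.uncurry k)) {C : ℝ}
    (hkC : ∀ a t, ‖k a t‖ ≤ C) {F : α → Lp ℂ p ν} (hF : ∀ a, F a =ᵐ[ν] k a)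
    {g : α → ℂ} (hg : Integrable g κ) (hgF : Integrable (fun a => g a • F a) κ) :
    ⇑(∫ a, g a • F a ∂κ) =ᵐ[ν] fun t => ∫ a, g a * k a t ∂κ := by
  have hprod (A : Set β) (hA : ν A < ∞) :
      Integrable (fun z : α × β => g z.1 * k z.1 z.2) (κ.prod (ν.restrict A)) := by
    have : IsFiniteMeasure (ν.restrict A) := ⟨by simpa using hA⟩
    exact (hg.comp_fst _).mul_bdd (c := C) hk.aestronglyMeasurable (.of_forall fun z => hkC _ _)
  refine ae_eq_of_forall_setIntegral_eq_of_sigmaFinite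
    (fun A _ hA => ?_) (fun A _ hA => (hprod A hA).integral_prod_right) fun A hmA hA => ?_
  · exact integrableOn_Lp_of_measure_ne_top _ Fact.out hA.ne
  let q := p.conjExponent
  have : Fact (1 ≤ q) := ⟨ENNReal.HolderConjugate.one_le q p⟩
  let L : Lp ℂ p ν →L[ℂ] ℂ :=
    (ContinuousLinearMap.mul ℂ ℂ).lpPairing ν q p (indicatorConstLp q hmA hA.ne (1 : ℂ))
  have hL (h : Lp ℂ p ν) : L h = ∫ t in A, h t ∂ν := by
    rw [← integral_indicator hmA]
    refine (ContinuousLinearMap.lpPairing_eq_integral _ _ _).trans (integral_congr_ae ?_)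
    filter_upwards [indicatorConstLp_coeFn (p := q) (hs := hmA) (hμs := hA.ne) (c := (1 : ℂ))]
      with t ht
    by_cases htA : t ∈ A <;> simp [ht, htA]
  rw [← hL, ← L.integral_comp_comm hgF, ← integral_integral_swap (hprod A hA)]
  refine integral_congr_ae (.of_forall fun a => ?_)
  change L (g a • F a) = ∫ t in A, g a * k a t ∂ν
  rw [map_smul, hL, smul_eq_mul, integral_const_mul, integral_congr_ae (ae_restrict_of_ae (hF a))]

theorem tendsto_eLpNorm_sub_of_dominated {α ι E : Type*} [MeasurableSpace α] {ν : Measure α}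
    [NormedAddCommGroup E] {l : Filter ι} [l.IsCountablyGenerated] {p : ℝ≥0∞} (hp0 : p ≠ 0)
    (hp : p ≠ ⊤) {F : ι → α → E} {f : α → E} {D : α → ℝ} (hD : MemLp D p ν)
    (hF : ∀ i, AEStronglyMeasurable (F i) ν) (hf : AEStronglyMeasurable f ν)
    (hFD : ∀ i, ∀ᵐ a ∂ν, ‖F i a‖ ≤ D a) (hfD : ∀ᵐ a ∂ν, ‖f a‖ ≤ D a)
    (hlim : ∀ᵐ a ∂ν, Tendsto (fun i => F i a) l (𝓝 (f a))) :
    Tendsto (fun i => eLpNorm (F i - f) p ν) l (𝓝 0) := by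
  have hp' : 0 < p.toReal := ENNReal.toReal_pos hp0 hp
  simp only [eLpNorm_eq_lintegral_rpow_enorm_toReal hp0 hp]
  have hD2 := (hD.add hD)
  have key : Tendsto (fun i => ∫⁻ a, ‖(F i - f) a‖ₑ ^ p.toReal ∂ν) l (𝓝 (∫⁻ _, 0 ∂ν)) := by
    refine tendsto_lintegral_filter_of_dominated_convergence'
      (fun a => ‖(D + D) a‖ₑ ^ p.toReal)
      (.of_forall fun i => ((hF i).sub hf).enorm.pow_const _) (.of_forall fun i => ?_)
      (lintegral_rpow_enorm_lt_top_of_eLpNorm_lt_top hp0 hp hD2.2).ne ?_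
    · filter_upwards [hFD i, hfD] with a h1 h2
      gcongr
      rw [enorm_le_iff_norm_le]
      exact (norm_sub_le _ _).trans ((add_le_add h1 h2).trans (le_abs_self _))
    · filter_upwards [hlim] with a ha
      have h := (ENNReal.continuous_rpow_const (y := p.toReal)).tendsto _ |>.comp
        (ha.sub_const (f a)).enorm
      simpa [Function.comp_def, hp'] using h
  have h := (ENNReal.continuous_rpow_const (y := 1 / p.toReal)).tendsto _ |>.comp key
  simpa [Function.comp_def, hp'] using h

theorem memLp_exp_neg_mul_abs_s11 {η : ℝ} (hη : 0 < η) {q : ℝ≥0∞} (hq : q ≠ 0) :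
    MemLp (fun s : ℝ => Real.exp (-η * |s|)) q volume := by
  have hm : AEStronglyMeasurable (fun s : ℝ => Real.exp (-η * |s|)) volume :=
    Continuous.aestronglyMeasurable (by fun_prop)
  rcases eq_or_ne q ⊤ with rfl | hq'
  · refine memLp_top_of_bound hm 1 (.of_forall fun s => ?_)
    rw [Real.norm_eq_abs, Real.abs_exp, Real.exp_le_one_iff]
    have := mul_nonneg hη.le (abs_nonneg s)
    linarith
  · rw [← integrable_norm_rpow_iff hm hq hq']
    have hc : 0 < η * q.toReal := mul_pos hη (ENNReal.toReal_pos hq hq')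
    have h2 : Integrable (fun s => Real.exp (-(η * q.toReal) * |s|)) volume := by
      rw [← integrableOn_univ, ← Iic_union_Ioi (a := (0 : ℝ)), integrableOn_union]
      constructor
      · refine (integrableOn_exp_mul_Iic hc 0).congr_fun (fun s hs => ?_) measurableSet_Iic
        simp [abs_of_nonpos (mem_Iic.1 hs)]
      · refine (integrableOn_exp_mul_Ioi (neg_lt_zero.2 hc) 0).congr_fun (fun s hs => ?_)
          measurableSet_Ioi
        simp [abs_of_pos (mem_Ioi.1 hs)]
    refine h2.congr (.of_forall fun s => ?_)
    simp only [Real.norm_eq_abs, Real.abs_exp, ← Real.exp_mul]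
    ring_nf

theorem exists_isCompactOperator_kernel {p q : ℝ≥0∞} [Fact (1 ≤ p)] [Fact (1 ≤ q)]
    [ENNReal.HolderConjugate q p] (hp : p ≠ ⊤) {k : ℝ → ℝ → ℂ}
    (hk : StronglyMeasurable (Function.uncurry k)) {D : ℝ → ℝ} (hD : MemLp D p volume) {C : ℝ}
    (hDC : ∀ t, D t ≤ C) (hkD : ∀ s t, ‖k s t‖ ≤ D t)
    (hcont : ∀ s, ∀ᵐ t, ContinuousAt (fun s => k s t) s)
    (hzero : ∀ t, Tendsto (fun s => k s t) (cocompact ℝ) (𝓝 0))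
    {c : ℝ → ℂ} (hc : MemLp c q volume) :
    ∃ K : Lp ℂ p (volume : Measure ℝ) →L[ℂ] Lp ℂ p (volume : Measure ℝ),
      (∀ φ, K φ =ᵐ[volume] fun t => ∫ s, c s * φ s * k s t) ∧ IsCompactOperator K := by
  have hp0 : p ≠ 0 := (zero_lt_one.trans_le (Fact.out : 1 ≤ p)).ne'
  have hkm (s : ℝ) : AEStronglyMeasurable (k s) volume :=
    (hk.comp_measurable measurable_prodMk_left).aestronglyMeasurable
  have hkp (s : ℝ) : MemLp (k s) p volume := hD.mono' (hkm s) (.of_forall (hkD s))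
  let F : ℝ → Lp ℂ p (volume : Measure ℝ) := fun s => (hkp s).toLp
  have hFcont : Continuous F := continuous_iff_continuousAt.2 fun s =>
    (Lp.tendsto_Lp_iff_tendsto_eLpNorm'' _ hkp _ (hkp s)).2 <|
      tendsto_eLpNorm_sub_of_dominated hp0 hp hD hkm (hkm s) (fun s => .of_forall (hkD s))
        (.of_forall (hkD s)) (hcont s)
  have hFzero : Tendsto F (cocompact ℝ) (𝓝 0) := by
    have : (cocompact ℝ).IsCountablyGenerated := by
      rw [cocompact_eq_atBot_atTop]; infer_instance
    have h := (Lp.tendsto_Lp_iff_tendsto_eLpNorm'' (fi := cocompact ℝ) k hkp 0 MemLp.zero).2 <|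
      tendsto_eLpNorm_sub_of_dominated hp0 hp hD hkm aestronglyMeasurable_zero
        (fun s => .of_forall (hkD s)) (.of_forall fun t => by
          simpa using (norm_nonneg _).trans (hkD 0 t)) (.of_forall hzero)
    simpa using h
  have hS := hFzero.isCompact_insert_range_of_cocompact hFcont
  have hFS (s : ℝ) : F s ∈ insert 0 (range F) := mem_insert_of_mem _ (mem_range_self s)
  obtain ⟨T, hT, hTc⟩ := exists_isCompactOperator_integral_smul (𝕜 := ℂ) (ν := volume)
    hFcont.aestronglyMeasurable hS hFS
  obtain ⟨R, hR⟩ := hS.isBounded.exists_norm_le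
  let M : Lp ℂ p (volume : Measure ℝ) →L[ℂ] Lp ℂ 1 (volume : Measure ℝ) :=
    (ContinuousLinearMap.mul ℂ ℂ).holderL volume q p 1 (hc.toLp c)
  refine ⟨T ∘L M, fun φ => ?_, hTc.comp_clm M⟩
  have hFint : Integrable (fun s => M φ s • F s) volume :=
    (L1.integrable_coeFn (M φ)).smul_of_top_left
      (memLp_top_of_bound hFcont.aestronglyMeasurable R (.of_forall fun s => hR _ (hFS s)))
  have h := coeFn_integral_smul_Lp hk (fun s t => (hkD s t).trans (hDC t))
    (fun s => (hkp s).coeFn_toLp) (L1.integrable_coeFn (M φ)) hFint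
  have hM : M φ =ᵐ[volume] fun s => c s * φ s := by
    refine (ContinuousLinearMap.coeFn_holder (ContinuousLinearMap.mul ℂ ℂ) (hc.toLp c) φ).trans ?_
    filter_upwards [hc.coeFn_toLp] with s hs
    simp [hs]
  rw [ContinuousLinearMap.comp_apply, hT]
  refine h.trans (.of_forall fun t => integral_congr_ae ?_)
  filter_upwards [hM] with s hs
  simp only [hs]

/-- The kernel `e^{-δ|t|} e^{μ(t-s)} (s-t)^r e^{-γ|s|}` on `t ≤ s`, extended by zero. -/
noncomputable def anticausalKernel (δ γ : ℝ) (r : ℕ) (μ : ℂ) (s t : ℝ) : ℂ :=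
  if t ≤ s then (Real.exp (-δ * |t|) : ℂ) * (Complex.exp (μ * ((t : ℂ) - (s : ℂ))) *
    ((s : ℂ) - (t : ℂ)) ^ r * (Real.exp (-γ * |s|) : ℂ)) else 0

theorem stronglyMeasurable_anticausalKernel (δ γ : ℝ) (r : ℕ) (μ : ℂ) :
    StronglyMeasurable (Function.uncurry (anticausalKernel δ γ r μ)) :=
  StronglyMeasurable.ite (measurableSet_le measurable_snd measurable_fst)
    (Continuous.stronglyMeasurable (by fun_prop)) stronglyMeasurable_zero

theorem continuousAt_anticausalKernel (δ γ : ℝ) (r : ℕ) (μ : ℂ) {s t : ℝ} (h : t ≠ s) :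
    ContinuousAt (fun s => anticausalKernel δ γ r μ s t) s := by
  rcases h.lt_or_gt with h | h
  · have : ContinuousAt (fun s : ℝ => (Real.exp (-δ * |t|) : ℂ) *
        (Complex.exp (μ * ((t : ℂ) - (s : ℂ))) * ((s : ℂ) - (t : ℂ)) ^ r *
          (Real.exp (-γ * |s|) : ℂ))) s := Continuous.continuousAt (by fun_prop)
    refine this.congr ?_
    filter_upwards [lt_mem_nhds h] with x hx
    simp [anticausalKernel, hx.le]
  · refine (continuousAt_const (y := (0 : ℂ))).congr ?_
    filter_upwards [gt_mem_nhds h] with x hx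
    simp [anticausalKernel, hx]

theorem norm_anticausalKernel_le {δ η : ℝ} (hη : 0 < η) (hηδ : 4 * η ≤ δ) (r : ℕ) {μ : ℂ}
    (hμ : 4 * η ≤ δ + μ.re) (s t : ℝ) :
    ‖anticausalKernel δ (δ - η) r μ s t‖ ≤
      (r.factorial / (2 * η) ^ r * Real.exp (-η * |t|)) * Real.exp (-η * |s|) := by
  have hC : (0 : ℝ) < r.factorial / (2 * η) ^ r := by positivity
  unfold anticausalKernel
  split_ifs with hts
  swap
  · simpa using by positivity
  have hst : 0 ≤ s - t := sub_nonneg.2 hts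
  have hpow : (s - t) ^ r ≤ r.factorial / (2 * η) ^ r * Real.exp (2 * η * (s - t)) := by
    have h := Real.pow_div_factorial_le_exp (2 * η * (s - t)) (by positivity) r
    rw [mul_pow, div_le_iff₀ (by positivity)] at h
    rw [div_mul_eq_mul_div, le_div_iff₀ (by positivity)]
    linarith
  have hnorm : ‖((s : ℂ) - (t : ℂ)) ^ r‖ = (s - t) ^ r := by
    rw [norm_pow, ← Complex.ofReal_sub, Complex.norm_real, Real.norm_of_nonneg hst]
  have hre : (μ * ((t : ℂ) - (s : ℂ))).re = μ.re * (t - s) := by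
    rw [← Complex.ofReal_sub, Complex.re_mul_ofReal]
  simp only [norm_mul, hnorm, Complex.norm_exp, hre, Complex.norm_real, Real.norm_eq_abs,
    Real.abs_exp]
  calc
    _ ≤ Real.exp (-δ * |t|) * (Real.exp (μ.re * (t - s)) *
        (r.factorial / (2 * η) ^ r * Real.exp (2 * η * (s - t))) *
          Real.exp (-(δ - η) * |s|)) := by gcongr
    _ = r.factorial / (2 * η) ^ r * Real.exp
        (-δ * |t| + μ.re * (t - s) + 2 * η * (s - t) + -(δ - η) * |s|) := by
      simp only [Real.exp_add]; ring
    _ ≤ r.factorial / (2 * η) ^ r * Real.exp (-η * |t| + -η * |s|) := by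
      refine mul_le_mul_of_nonneg_left (Real.exp_le_exp.2 ?_) hC.le
      have hst' : s - t ≤ |s| + |t| := by linarith [le_abs_self s, neg_abs_le t]
      have h1 := mul_le_mul_of_nonneg_left hst' (by linarith : 0 ≤ δ - 2 * η)
      have h2 := mul_nonneg hst (by linarith : 0 ≤ δ + μ.re - 4 * η)
      have h3 := mul_nonneg hη.le (abs_nonneg t)
      nlinarith
    _ = _ := by rw [Real.exp_add]; ring

/-- For `δ > 0`, `r ∈ ℕ`, `b ∈ L_∞(ℝ)`, `1 ≤ p < ∞` and `Re μ > -δ`,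
the weighted anticausal formula
`(Kφ)(t) = e^{-δ|t|} ∫_t^{+∞} e^{μ(t-s)}(s-t)^r e^{-δ|s|} b(s) φ(s) ds`
defines a bounded linear operator on `L_p(ℝ)` which is compact. -/
theorem statement11 (δ : ℝ) (hδ : 0 < δ) (r : ℕ)
    (b : Lp ℂ ⊤ (volume : Measure ℝ))
    (p : ENNReal) [Fact (1 ≤ p)] (hp2 : p ≠ ⊤)
    (μ : ℂ) (hμ : -δ < μ.re) :
    ∃ K : Lp ℂ p (volume : Measure ℝ) →L[ℂ] Lp ℂ p (volume : Measure ℝ),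
      (∀ φ : Lp ℂ p (volume : Measure ℝ), ∀ᵐ t : ℝ ∂volume,
        (K φ : ℝ → ℂ) t = (Real.exp (-δ * |t|) : ℂ) * ∫ s in Set.Ici t,
          Complex.exp (μ * ((t : ℂ) - (s : ℂ))) * ((s : ℂ) - (t : ℂ)) ^ r *
            (Real.exp (-δ * |s|) : ℂ) * (b : ℝ → ℂ) s * (φ : ℝ → ℂ) s) ∧
      IsCompactOperator K := by
  obtain ⟨η, hη, hηδ, hημ⟩ : ∃ η : ℝ, 0 < η ∧ 4 * η ≤ δ ∧ 4 * η ≤ δ + μ.re := by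
    have hpos : 0 < min δ (δ + μ.re) := lt_min hδ (by linarith)
    exact ⟨min δ (δ + μ.re) / 4, by linarith, by linarith [min_le_left δ (δ + μ.re)],
      by linarith [min_le_right δ (δ + μ.re)]⟩
  let q := p.conjExponent
  have : Fact (1 ≤ q) := ⟨ENNReal.HolderConjugate.one_le q p⟩
  have hp0 : p ≠ 0 := (zero_lt_one.trans_le (Fact.out : 1 ≤ p)).ne'
  have hq0 : q ≠ 0 := (zero_lt_one.trans_le (Fact.out : 1 ≤ q)).ne'
  let k := anticausalKernel δ (δ - η) r μ
  let C : ℝ := r.factorial / (2 * η) ^ r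
  have hC : 0 ≤ C := by positivity
  have hexp (x : ℝ) : Real.exp (-η * |x|) ≤ 1 :=
    Real.exp_le_one_iff.2 (by nlinarith [mul_nonneg hη.le (abs_nonneg x)])
  have hkb (s t : ℝ) : ‖k s t‖ ≤ C * Real.exp (-η * |t|) * Real.exp (-η * |s|) :=
    norm_anticausalKernel_le hη hηδ r hημ s t
  have hc : MemLp (fun s => b s * (Real.exp (-η * |s|) : ℂ)) q volume :=
    (memLp_exp_neg_mul_abs_s11 hη hq0).ofReal.mul (Lp.memLp b)
  have hzero (t : ℝ) : Tendsto (fun s => k s t) (cocompact ℝ) (𝓝 0) := by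
    refine squeeze_zero_norm (fun s => hkb s t) ?_
    have h : Tendsto (fun s : ℝ => Real.exp (-η * |s|)) (cocompact ℝ) (𝓝 0) :=
      Real.tendsto_exp_atBot.comp
        ((tendsto_norm_cocompact_atTop (E := ℝ)).const_mul_atTop_of_neg (neg_lt_zero.2 hη))
    simpa using h.const_mul (C * Real.exp (-η * |t|))
  obtain ⟨K, hK, hKc⟩ := exists_isCompactOperator_kernel hp2
    (stronglyMeasurable_anticausalKernel δ (δ - η) r μ)
    ((memLp_exp_neg_mul_abs_s11 hη hp0).const_mul C)
    (fun t => mul_le_of_le_one_right hC (hexp t))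
    (fun s t => (hkb s t).trans (mul_le_of_le_one_right (by positivity) (hexp s)))
    (fun s => (Measure.ae_ne volume s).mono fun t => continuousAt_anticausalKernel _ _ _ _)
    hzero hc
  refine ⟨K, fun φ => (hK φ).mono fun t ht => ?_, hKc⟩
  rw [ht, ← integral_const_mul, ← integral_indicator measurableSet_Ici]
  refine integral_congr_ae (.of_forall fun s => ?_)
  by_cases hts : t ≤ s
  · have hsplit : Real.exp (-δ * |s|) = Real.exp (-(δ - η) * |s|) * Real.exp (-η * |s|) := by
      rw [← Real.exp_add]; ring_nf
    simp only [anticausalKernel, hts, if_true, mem_Ici, indicator_of_mem, hsplit,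
      Complex.ofReal_mul]
    ring
  · simp [anticausalKernel, hts]
end
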